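/- In the polynomial ring ℤ[x₁,x₂,x₃], the degree-6 homogeneous component of ∏_{1≤i≤j≤l≤3} (1 + xᵢ + xⱼ + x_l) equals 12e₁⁶ + 282e₁⁴e₂ + 679e₁³e₃ + 593e₁²e₂² + 792e₁e₂e₃ + 85e₂³ + 27e₃². -/

import Mathlib

open MvPolynomial

/-- `x₁`, `x₂`, `x₃` in `ℤ[x₁,x₂,x₃]`. -/
noncomputable def x1 : MvPolynomial (Fin 3) ℤ := X 0
noncomputable def x2 : MvPolynomial (Fin 3) ℤ := X 1
noncomputable def x3 : MvPolynomial (Fin 3) ℤ := X 2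

/-- the elementary symmetric polynomials in three variables -/
noncomputable def e1 : MvPolynomial (Fin 3) ℤ := x1 + x2 + x3
noncomputable def e2 : MvPolynomial (Fin 3) ℤ := x1*x2 + x1*x3 + x2*x3
noncomputable def e3 : MvPolynomial (Fin 3) ℤ := x1*x2*x3

/-- The product `∏_{1≤i≤j≤l≤3} (1 + xᵢ + xⱼ + x_l)` over the ten triples
`(i,j,l)` with `1 ≤ i ≤ j ≤ l ≤ 3`; by the splitting principle this is the
total Chern class of `S³E` for `E` of rank `3` with Chern roots `x₁,x₂,x₃`. -/
noncomputable def sym3Prod : MvPolynomial (Fin 3) ℤ :=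
  (1 + x1 + x1 + x1) * (1 + x1 + x1 + x2) * (1 + x1 + x1 + x3) *
  (1 + x1 + x2 + x2) * (1 + x1 + x2 + x3) * (1 + x1 + x3 + x3) *
  (1 + x2 + x2 + x2) * (1 + x2 + x2 + x3) * (1 + x2 + x3 + x3) *
  (1 + x3 + x3 + x3)

/-- A weighted monomial in the elementary symmetric polynomials. -/
noncomputable def mon (k : ℤ) (a b c : ℕ) : MvPolynomial (Fin 3) ℤ :=
  C k * e1 ^ a * e2 ^ b * e3 ^ c

lemma mon_homog (k : ℤ) (a b c : ℕ) : (mon k a b c).IsHomogeneous (a + 2 * b + 3 * c) := by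
  have h1 : x1.IsHomogeneous 1 := isHomogeneous_X _ _
  have h2 : x2.IsHomogeneous 1 := isHomogeneous_X _ _
  have h3 : x3.IsHomogeneous 1 := isHomogeneous_X _ _
  have g1 : e1.IsHomogeneous 1 := (h1.add h2).add h3
  have g2 : e2.IsHomogeneous 2 := ((h1.mul h2).add (h1.mul h3)).add (h2.mul h3)
  have g3 : e3.IsHomogeneous 3 := (h1.mul h2).mul h3
  have := (((isHomogeneous_C (Fin 3) k).mul (g1.pow a)).mul (g2.pow b)).mul (g3.pow c)
  unfold mon
  convert this using 1
  ring

lemma comp_mon (k : ℤ) (a b c : ℕ) :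
    homogeneousComponent 6 (mon k a b c) = if 6 = a + 2 * b + 3 * c then mon k a b c else 0 := by
  split_ifs with h
  · have := mon_homog k a b c
    rw [← h] at this
    exact homogeneousComponent_eq_self this
  · rw [homogeneousComponent_of_mem (mon_homog k a b c), if_neg (fun h' => h (by omega))]

lemma mon_eq (k : ℤ) (a b c : ℕ) : mon k a b c = (k : MvPolynomial (Fin 3) ℤ) * e1 ^ a * e2 ^ b * e3 ^ c := by
  rw [mon, ← eq_intCast (C : ℤ →+* MvPolynomial (Fin 3) ℤ) k]

lemma prod_cube (x y z : MvPolynomial (Fin 3) ℤ) :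
  (1 + x + x + x) * (1 + x + x + y) * (1 + x + x + z) *
  (1 + x + y + y) * (1 + x + y + z) * (1 + x + z + z) *
  (1 + y + y + y) * (1 + y + y + z) * (1 + y + z + z) *
  (1 + z + z + z) = 1*(x + y + z)^0*(x*y + x*z + y*z)^0*(x*y*z)^0 +
    10*(x + y + z)^1*(x*y + x*z + y*z)^0*(x*y*z)^0 +
    40*(x + y + z)^2*(x*y + x*z + y*z)^0*(x*y*z)^0 + 15*(x + y + z)^0*(x*y + x*z + y*z)^1*(x*y*z)^0 +
    82*(x + y + z)^3*(x*y + x*z + y*z)^0*(x*y*z)^0 + 111*(x + y + z)^1*(x*y + x*z + y*z)^1*(x*y*z)^0 + 27*(x + y + z)^0*(x*y + x*z + y*z)^0*(x*y*z)^1 +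
    91*(x + y + z)^4*(x*y + x*z + y*z)^0*(x*y*z)^0 + 315*(x + y + z)^2*(x*y + x*z + y*z)^1*(x*y*z)^0 + 63*(x + y + z)^0*(x*y + x*z + y*z)^2*(x*y*z)^0 + 189*(x + y + z)^1*(x*y + x*z + y*z)^0*(x*y*z)^1 +
    52*(x + y + z)^5*(x*y + x*z + y*z)^0*(x*y*z)^0 + 429*(x + y + z)^3*(x*y + x*z + y*z)^1*(x*y*z)^0 + 324*(x + y + z)^1*(x*y + x*z + y*z)^2*(x*y*z)^0 + 513*(x + y + z)^2*(x*y + x*z + y*z)^0*(x*y*z)^1 + 162*(x + y + z)^0*(x*y + x*z + y*z)^1*(x*y*z)^1 +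
    12*(x + y + z)^6*(x*y + x*z + y*z)^0*(x*y*z)^0 + 282*(x + y + z)^4*(x*y + x*z + y*z)^1*(x*y*z)^0 + 593*(x + y + z)^2*(x*y + x*z + y*z)^2*(x*y*z)^0 + 85*(x + y + z)^0*(x*y + x*z + y*z)^3*(x*y*z)^0 + 679*(x + y + z)^3*(x*y + x*z + y*z)^0*(x*y*z)^1 + 792*(x + y + z)^1*(x*y + x*z + y*z)^1*(x*y*z)^1 + 27*(x + y + z)^0*(x*y + x*z + y*z)^0*(x*y*z)^2 +
    72*(x + y + z)^5*(x*y + x*z + y*z)^1*(x*y*z)^0 + 464*(x + y + z)^3*(x*y + x*z + y*z)^2*(x*y*z)^0 + 259*(x + y + z)^1*(x*y + x*z + y*z)^3*(x*y*z)^0 + 448*(x + y + z)^4*(x*y + x*z + y*z)^0*(x*y*z)^1 + 1386*(x + y + z)^2*(x*y + x*z + y*z)^1*(x*y*z)^1 + 243*(x + y + z)^0*(x*y + x*z + y*z)^2*(x*y*z)^1 + 108*(x + y + z)^1*(x*y + x*z + y*z)^0*(x*y*z)^2 +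
    132*(x + y + z)^4*(x*y + x*z + y*z)^2*(x*y*z)^0 + 246*(x + y + z)^2*(x*y + x*z + y*z)^3*(x*y*z)^0 + 36*(x + y + z)^0*(x*y + x*z + y*z)^4*(x*y*z)^0 + 120*(x + y + z)^5*(x*y + x*z + y*z)^0*(x*y*z)^1 + 1116*(x + y + z)^3*(x*y + x*z + y*z)^1*(x*y*z)^1 + 567*(x + y + z)^1*(x*y + x*z + y*z)^2*(x*y*z)^1 + 81*(x + y + z)^2*(x*y + x*z + y*z)^0*(x*y*z)^2 + 243*(x + y + z)^0*(x*y + x*z + y*z)^1*(x*y*z)^2 +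
    72*(x + y + z)^3*(x*y + x*z + y*z)^3*(x*y*z)^0 + 36*(x + y + z)^1*(x*y + x*z + y*z)^4*(x*y*z)^0 + 360*(x + y + z)^4*(x*y + x*z + y*z)^1*(x*y*z)^1 + 540*(x + y + z)^2*(x*y + x*z + y*z)^2*(x*y*z)^1 + 108*(x + y + z)^0*(x*y + x*z + y*z)^3*(x*y*z)^1 + 108*(x + y + z)^3*(x*y + x*z + y*z)^0*(x*y*z)^2 + (-243)*(x + y + z)^1*(x*y + x*z + y*z)^1*(x*y*z)^2 + 729*(x + y + z)^0*(x*y + x*z + y*z)^0*(x*y*z)^3 +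
    216*(x + y + z)^3*(x*y + x*z + y*z)^2*(x*y*z)^1 + 108*(x + y + z)^1*(x*y + x*z + y*z)^3*(x*y*z)^1 + 108*(x + y + z)^4*(x*y + x*z + y*z)^0*(x*y*z)^2 + (-486)*(x + y + z)^2*(x*y + x*z + y*z)^1*(x*y*z)^2 + 729*(x + y + z)^1*(x*y + x*z + y*z)^0*(x*y*z)^3 := by
  ring

set_option maxRecDepth 10000 in
lemma sym3Prod_eq : sym3Prod =
    (mon (1) 0 0 0) +
    (mon (10) 1 0 0) +
    (mon (40) 2 0 0 + mon (15) 0 1 0) +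
    (mon (82) 3 0 0 + mon (111) 1 1 0 + mon (27) 0 0 1) +
    (mon (91) 4 0 0 + mon (315) 2 1 0 + mon (63) 0 2 0 + mon (189) 1 0 1) +
    (mon (52) 5 0 0 + mon (429) 3 1 0 + mon (324) 1 2 0 + mon (513) 2 0 1 + mon (162) 0 1 1) +
    (mon (12) 6 0 0 + mon (282) 4 1 0 + mon (593) 2 2 0 + mon (85) 0 3 0 + mon (679) 3 0 1 + mon (792) 1 1 1 + mon (27) 0 0 2) +
    (mon (72) 5 1 0 + mon (464) 3 2 0 + mon (259) 1 3 0 + mon (448) 4 0 1 + mon (1386) 2 1 1 + mon (243) 0 2 1 + mon (108) 1 0 2) +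
    (mon (132) 4 2 0 + mon (246) 2 3 0 + mon (36) 0 4 0 + mon (120) 5 0 1 + mon (1116) 3 1 1 + mon (567) 1 2 1 + mon (81) 2 0 2 + mon (243) 0 1 2) +
    (mon (72) 3 3 0 + mon (36) 1 4 0 + mon (360) 4 1 1 + mon (540) 2 2 1 + mon (108) 0 3 1 + mon (108) 3 0 2 + mon (-243) 1 1 2 + mon (729) 0 0 3) +
    (mon (216) 3 2 1 + mon (108) 1 3 1 + mon (108) 4 0 2 + mon (-486) 2 1 2 + mon (729) 1 0 3) := by
  have h := prod_cube x1 x2 x3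
  rw [sym3Prod, h]
  simp only [mon_eq, e1, e2, e3]
  push_cast
  ring

/-- The paper's formula for `c_6(S³E)`: the degree-`6` homogeneous component
of `∏_{1≤i≤j≤l≤3} (1 + xᵢ + xⱼ + x_l)`. -/
theorem chern_sym3_deg6 :
    homogeneousComponent 6 sym3Prod = 12*e1^6 + 282*e1^4*e2 + 679*e1^3*e3 + 593*e1^2*e2^2 + 792*e1*e2*e3 + 85*e2^3 + 27*e3^2 := by
  rw [sym3Prod_eq]
  simp only [map_add, comp_mon]
  norm_num
  simp only [mon_eq]
  push_cast
  ring
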